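/- arXiv:2506.04003 — 3 statements merged into one kernel-verified Lean document; each statement's English description precedes it below -/
import Mathlib

section
/- Let (X,d) be a compact metric space of diameter D_X, μ, ν Borel probability measures on X, and f, g : X → ℝ metric observables. Write f_μ = f − ∫f dμ, g_μ = g − ∫g dμ, f_ν = f − ∫f dν, g_ν = g − ∫g dν. Then for every coupling h of μ and ν, |∫_X f_μ g_μ dμ − ∫_X f_ν g_ν dν| ≤ 4 D_X · ∫_{X×X} d(x,y) dh(x,y); hence |Σ_μ(f_μ, g_μ) − Σ_ν(f_ν, g_ν)| ≤ 4 D_X · w₁(μ,ν). -/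
open MeasureTheory Metric

/-- On a compact space a `1`-Lipschitz function differs from its mean by at most the diameter. -/
theorem abs_sub_integral_le_diam {X : Type*} [MetricSpace X] [CompactSpace X]
    [MeasurableSpace X] [BorelSpace X] (μ : Measure X) [IsProbabilityMeasure μ]
    {f : X → ℝ} (hf : LipschitzWith 1 f) (x : X) :
    |f x - ∫ y, f y ∂μ| ≤ diam (Set.univ : Set X) := by
  have hfi : Integrable f μ := hf.continuous.integrable_of_hasCompactSupport
    (HasCompactSupport.of_compactSpace f)
  have heq : f x - ∫ y, f y ∂μ = ∫ y, (f x - f y) ∂μ := by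
    rw [integral_sub (integrable_const _) hfi]; simp
  have hbound : ∀ y, ‖f x - f y‖ ≤ diam (Set.univ : Set X) := fun y => by
    rw [← dist_eq_norm]
    exact (hf.dist_le_mul x y).trans (by
      simpa using dist_le_diam_of_mem isCompact_univ.isBounded (Set.mem_univ x) (Set.mem_univ y))
  rw [heq]
  simpa using norm_integral_le_of_norm_le_const (μ := μ) (.of_forall hbound)

/-- The centered covariances of two `1`-Lipschitz functions under the two marginals of `h` differ
by at most `4 * diam X` times the transport cost of `h`. -/
theorem abs_centered_covariance_marginals_sub_le {X : Type*} [MetricSpace X] [CompactSpace X]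
    [MeasurableSpace X] [BorelSpace X] (h : Measure (X × X)) [IsProbabilityMeasure h]
    {μ ν : Measure X} [IsProbabilityMeasure μ] [IsProbabilityMeasure ν]
    (hμ : h.map Prod.fst = μ) (hν : h.map Prod.snd = ν)
    {f g : X → ℝ} (hf : LipschitzWith 1 f) (hg : LipschitzWith 1 g) :
    |∫ x, (f x - ∫ y, f y ∂μ) * (g x - ∫ y, g y ∂μ) ∂μ -
      ∫ x, (f x - ∫ y, f y ∂ν) * (g x - ∫ y, g y ∂ν) ∂ν| ≤
      4 * diam (Set.univ : Set X) * ∫ p : X × X, dist p.1 p.2 ∂h := by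
  have hint : ∀ φ : X × X → ℝ, Continuous φ → Integrable φ h := fun φ hφ =>
    hφ.integrable_of_hasCompactSupport (HasCompactSupport.of_compactSpace φ)
  have hfst : ∀ φ : X → ℝ, Continuous φ → ∫ x, φ x ∂μ = ∫ p, φ p.1 ∂h := fun φ hφ => by
    rw [← hμ, integral_map measurable_fst.aemeasurable hφ.aestronglyMeasurable]
  have hsnd : ∀ φ : X → ℝ, Continuous φ → ∫ x, φ x ∂ν = ∫ p, φ p.2 ∂h := fun φ hφ => by
    rw [← hν, integral_map measurable_snd.aemeasurable hφ.aestronglyMeasurable]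
  have hdist : Integrable (fun p : X × X => dist p.1 p.2) h := hint _ continuous_dist
  have hlip : ∀ φ : X → ℝ, LipschitzWith 1 φ → ∀ x y, |φ x - φ y| ≤ dist x y :=
    fun φ hφ x y => by simpa [Real.dist_eq] using hφ.dist_le_mul x y
  have hmean : ∀ φ : X → ℝ, LipschitzWith 1 φ →
      |∫ x, φ x ∂μ - ∫ x, φ x ∂ν| ≤ ∫ p : X × X, dist p.1 p.2 ∂h := fun φ hφ => by
    have hc := hφ.continuous
    rw [hfst φ hc, hsnd φ hc, ← integral_sub (hint _ (by fun_prop)) (hint _ (by fun_prop))]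
    exact norm_integral_le_of_norm_le (f := fun p : X × X => φ p.1 - φ p.2) hdist
      (.of_forall fun p => hlip φ hφ p.1 p.2)
  have hfc := hf.continuous
  have hgc := hg.continuous
  have hfm := hmean f hf
  have hgm := hmean g hg
  have hfD := abs_sub_integral_le_diam μ hf
  have hgD := abs_sub_integral_le_diam ν hg
  set a := ∫ x, f x ∂μ
  set b := ∫ x, g x ∂μ
  set a' := ∫ x, f x ∂ν
  set b' := ∫ x, g x ∂ν
  set D := diam (Set.univ : Set X)
  set W := ∫ p : X × X, dist p.1 p.2 ∂h with hW
  have hD : 0 ≤ D := diam_nonneg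
  rw [hfst (fun x => (f x - a) * (g x - b)) (by fun_prop),
    hsnd (fun x => (f x - a') * (g x - b')) (by fun_prop),
    ← integral_sub (hint _ (by fun_prop)) (hint _ (by fun_prop))]
  have hpt : ∀ p : X × X, ‖(f p.1 - a) * (g p.1 - b) - (f p.2 - a') * (g p.2 - b')‖ ≤
      2 * D * (dist p.1 p.2 + W) := fun p => by
    have hfd : |(f p.1 - a) - (f p.2 - a')| ≤ dist p.1 p.2 + W := by
      rw [show (f p.1 - a) - (f p.2 - a') = (f p.1 - f p.2) - (a - a') by ring]
      exact (abs_sub _ _).trans (add_le_add (hlip f hf _ _) hfm)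
    have hgd : |(g p.1 - b) - (g p.2 - b')| ≤ dist p.1 p.2 + W := by
      rw [show (g p.1 - b) - (g p.2 - b') = (g p.1 - g p.2) - (b - b') by ring]
      exact (abs_sub _ _).trans (add_le_add (hlip g hg _ _) hgm)
    calc ‖(f p.1 - a) * (g p.1 - b) - (f p.2 - a') * (g p.2 - b')‖
        = |(f p.1 - a) * ((g p.1 - b) - (g p.2 - b')) +
            (g p.2 - b') * ((f p.1 - a) - (f p.2 - a'))| := by
          rw [Real.norm_eq_abs]; congr 1; ring
      _ ≤ |f p.1 - a| * |(g p.1 - b) - (g p.2 - b')| +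
            |g p.2 - b'| * |(f p.1 - a) - (f p.2 - a')| := by
          rw [← abs_mul, ← abs_mul]; exact abs_add_le _ _
      _ ≤ D * (dist p.1 p.2 + W) + D * (dist p.1 p.2 + W) := by
          gcongr
          · exact hfD p.1
          · exact hgD p.2
      _ = 2 * D * (dist p.1 p.2 + W) := by ring
  refine (norm_integral_le_of_norm_le (hint _ (by fun_prop)) (.of_forall hpt)).trans_eq ?_
  rw [integral_const_mul, integral_add hdist (integrable_const _), ← hW]
  simp
  ring

/-- For metric observables `f, g` and probability measures `μ, ν` on a
compact metric space of diameter `D_X`, writing `f_μ = f - ∫ f dμ` etc., for every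
coupling `h` of `μ` and `ν` one has
`|Σ_μ(f_μ,g_μ) - Σ_ν(f_ν,g_ν)| ≤ 4 D_X ∫ d(x,y) dh`, hence
`|Σ_μ(f_μ,g_μ) - Σ_ν(f_ν,g_ν)| ≤ 4 D_X w₁(μ,ν)`. -/
theorem centered_covariance_coupling_bound {X : Type*} [MetricSpace X] [CompactSpace X]
    [MeasurableSpace X] [BorelSpace X]
    (μ ν : Measure X) [IsProbabilityMeasure μ] [IsProbabilityMeasure ν]
    (f g : X → ℝ) (hf : LipschitzWith 1 f) (hg : LipschitzWith 1 g) :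
    (∀ h : Measure (X × X), IsProbabilityMeasure h →
      h.map Prod.fst = μ → h.map Prod.snd = ν →
      |∫ x, (f x - ∫ y, f y ∂μ) * (g x - ∫ y, g y ∂μ) ∂μ -
        ∫ x, (f x - ∫ y, f y ∂ν) * (g x - ∫ y, g y ∂ν) ∂ν| ≤
        4 * diam (Set.univ : Set X) * ∫ p : X × X, dist p.1 p.2 ∂h) ∧
    |∫ x, (f x - ∫ y, f y ∂μ) * (g x - ∫ y, g y ∂μ) ∂μ -
      ∫ x, (f x - ∫ y, f y ∂ν) * (g x - ∫ y, g y ∂ν) ∂ν| ≤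
      4 * diam (Set.univ : Set X) *
        ⨅ h : {h : Measure (X × X) // IsProbabilityMeasure h ∧
            h.map Prod.fst = μ ∧ h.map Prod.snd = ν},
          ∫ p : X × X, dist p.1 p.2 ∂h.1 := by
  have hle : ∀ h : Measure (X × X), IsProbabilityMeasure h →
      h.map Prod.fst = μ → h.map Prod.snd = ν → _ :=
    fun h _ hμ hν => abs_centered_covariance_marginals_sub_le h hμ hν hf hg
  refine ⟨hle, ?_⟩
  have : Nonempty {h : Measure (X × X) // IsProbabilityMeasure h ∧
      h.map Prod.fst = μ ∧ h.map Prod.snd = ν} :=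
    ⟨⟨μ.prod ν, inferInstance, by simp [Measure.map_fst_prod], by simp [Measure.map_snd_prod]⟩⟩
  rw [Real.mul_iInf_of_nonneg (mul_nonneg zero_le_four diam_nonneg)]
  exact le_ciInf fun h => hle h.1 h.2.1 h.2.2.1 h.2.2.2
end

section
/- Let (X,d) be a compact metric space of diameter D_X, let C_X = max{1, 4 D_X}, and let μ, ν be Borel probability measures on X. For every coupling h of μ and ν and every ε > C_X · ∫_{X×X} d(x,y) dh(x,y): (a) for every pair (f,g) of μ-centered metric observables there exists a pair (f',g') of ν-centered metric observables with max{‖f−f'‖_∞, ‖g−g'‖_∞} < ε and |Σ_μ(f,g) − Σ_ν(f',g')| < ε; and (b) for every pair (f',g') of ν-centered metric observables there exists a pair (f,g) of μ-centered metric observables with max{‖f−f'‖_∞, ‖g−g'‖_∞} < ε and |Σ_μ(f,g) − Σ_ν(f',g')| < ε. Consequently the Hausdorff distance d_H(Σ_μ, Σ_ν), defined as the infimum of admissible ε, satisfies d_H(Σ_μ, Σ_ν) ≤ C_X · w₁(μ,ν). -/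
open MeasureTheory Metric

/-- `ε` is admissible for the pair of observable covariances `(Σ_μ, Σ_ν)`: every pair of
μ-centered metric observables is within `ε` (in the max sup-norm metric) of a pair of
ν-centered metric observables with covariance values within `ε`, and vice versa. -/
def Admissible {X : Type*} [MetricSpace X] [MeasurableSpace X]
    (μ ν : Measure X) (ε : ℝ) : Prop :=
  (∀ f g : X → ℝ, LipschitzWith 1 f → ∫ x, f x ∂μ = 0 →
    LipschitzWith 1 g → ∫ x, g x ∂μ = 0 →
    ∃ f' g' : X → ℝ, LipschitzWith 1 f' ∧ ∫ x, f' x ∂ν = 0 ∧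
      LipschitzWith 1 g' ∧ ∫ x, g' x ∂ν = 0 ∧
      max (⨆ x : X, |f x - f' x|) (⨆ x : X, |g x - g' x|) < ε ∧
      |∫ x, f x * g x ∂μ - ∫ x, f' x * g' x ∂ν| < ε) ∧
  (∀ f' g' : X → ℝ, LipschitzWith 1 f' → ∫ x, f' x ∂ν = 0 →
    LipschitzWith 1 g' → ∫ x, g' x ∂ν = 0 →
    ∃ f g : X → ℝ, LipschitzWith 1 f ∧ ∫ x, f x ∂μ = 0 ∧
      LipschitzWith 1 g ∧ ∫ x, g x ∂μ = 0 ∧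
      max (⨆ x : X, |f x - f' x|) (⨆ x : X, |g x - g' x|) < ε ∧
      |∫ x, f x * g x ∂μ - ∫ x, f' x * g' x ∂ν| < ε)

/-- On a compact space, a continuous real function is integrable for every finite measure. -/
theorem integrable_of_continuous_compact {Y : Type*} [TopologicalSpace Y] [CompactSpace Y]
    [MeasurableSpace Y] [OpensMeasurableSpace Y]
    (μ : Measure Y) [IsFiniteMeasure μ] {f : Y → ℝ} (hf : Continuous f) : Integrable f μ :=
  hf.integrable_of_hasCompactSupport (HasCompactSupport.of_compactSpace f)

theorem dist_le_diam_univ {X : Type*} [MetricSpace X] [CompactSpace X]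
    (x y : X) : dist x y ≤ diam (Set.univ : Set X) :=
  dist_le_diam_of_mem isCompact_univ.isBounded (Set.mem_univ x) (Set.mem_univ y)

section Coupling

variable {X : Type*} [MetricSpace X] [CompactSpace X] [MeasurableSpace X] [BorelSpace X]

/-- If the increments of a continuous function are bounded by `K * d`, then the integrals against
the two marginals of a coupling differ by at most `K * ∫ d`. -/
theorem abs_integral_fst_sub_integral_snd_le (h : Measure (X × X)) [IsProbabilityMeasure h]
    {φ : X → ℝ} (hφ : Continuous φ) {K : ℝ} (hK : ∀ x y, |φ x - φ y| ≤ K * dist x y) :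
    |∫ x, φ x ∂(h.map Prod.fst) - ∫ x, φ x ∂(h.map Prod.snd)| ≤
      K * ∫ p : X × X, dist p.1 p.2 ∂h := by
  rw [integral_map measurable_fst.aemeasurable hφ.aestronglyMeasurable,
    integral_map measurable_snd.aemeasurable hφ.aestronglyMeasurable,
    ← integral_sub (integrable_of_continuous_compact h (by fun_prop))
      (integrable_of_continuous_compact h (by fun_prop)), ← integral_const_mul]
  refine (abs_integral_le_integral_abs).trans (integral_mono ?_ ?_ fun p => hK p.1 p.2)
  · exact integrable_of_continuous_compact h (by fun_prop)
  · exact integrable_of_continuous_compact h (by fun_prop)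

theorem integral_dist_le_diam (h : Measure (X × X)) [IsProbabilityMeasure h] :
    ∫ p : X × X, dist p.1 p.2 ∂h ≤ diam (Set.univ : Set X) := by
  calc ∫ p : X × X, dist p.1 p.2 ∂h ≤ ∫ _ : X × X, diam (Set.univ : Set X) ∂h :=
        integral_mono (integrable_of_continuous_compact h (by fun_prop)) (integrable_const _)
          fun p => dist_le_diam_univ p.1 p.2
    _ = diam (Set.univ : Set X) := by simp

/-- A centered metric observable is bounded by the diameter. -/
theorem abs_le_diam_of_integral_eq_zero (μ : Measure X) [IsProbabilityMeasure μ] {f : X → ℝ}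
    (hf : LipschitzWith 1 f) (h0 : ∫ x, f x ∂μ = 0) (x : X) :
    |f x| ≤ diam (Set.univ : Set X) := by
  have hi := integrable_of_continuous_compact μ hf.continuous
  have hx : f x = ∫ y, (f x - f y) ∂μ := by
    rw [integral_sub (integrable_const _) hi, h0]; simp
  rw [hx, ← Real.norm_eq_abs]
  refine (norm_integral_le_of_norm_le_const (C := diam (Set.univ : Set X))
    (Filter.Eventually.of_forall fun y => ?_)).trans (by simp)
  rw [← dist_eq_norm]
  exact (hf.dist_le_mul x y).trans (by simpa using dist_le_diam_univ x y)

/-- Recentering at the second marginal of a coupling moves centered observables and their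
covariance by at most the transport cost, up to the constant `max 1 (4 * diam X)`. -/
theorem exists_recentered_observables (h : Measure (X × X)) [IsProbabilityMeasure h] {ε : ℝ}
    (hε : max 1 (4 * diam (Set.univ : Set X)) * (∫ p : X × X, dist p.1 p.2 ∂h) < ε)
    (f g : X → ℝ) (hf : LipschitzWith 1 f) (hf0 : ∫ x, f x ∂(h.map Prod.fst) = 0)
    (hg : LipschitzWith 1 g) (hg0 : ∫ x, g x ∂(h.map Prod.fst) = 0) :
    ∃ f' g' : X → ℝ, LipschitzWith 1 f' ∧ ∫ x, f' x ∂(h.map Prod.snd) = 0 ∧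
      LipschitzWith 1 g' ∧ ∫ x, g' x ∂(h.map Prod.snd) = 0 ∧
      max (⨆ x : X, |f x - f' x|) (⨆ x : X, |g x - g' x|) < ε ∧
      |∫ x, f x * g x ∂(h.map Prod.fst) - ∫ x, f' x * g' x ∂(h.map Prod.snd)| < ε := by
  have : IsProbabilityMeasure (h.map Prod.fst) :=
    Measure.isProbabilityMeasure_map measurable_fst.aemeasurable
  have : IsProbabilityMeasure (h.map Prod.snd) :=
    Measure.isProbabilityMeasure_map measurable_snd.aemeasurable
  have hfc := hf.continuous
  have hgc := hg.continuous
  have hfD := abs_le_diam_of_integral_eq_zero _ hf hf0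
  have hgD := abs_le_diam_of_integral_eq_zero _ hg hg0
  have hfL (x y : X) : |f x - f y| ≤ 1 * dist x y := hf.dist_le_mul x y
  have hgL (x y : X) : |g x - g y| ≤ 1 * dist x y := hg.dist_le_mul x y
  have hWD := integral_dist_le_diam h
  have hW0 : 0 ≤ ∫ p : X × X, dist p.1 p.2 ∂h := integral_nonneg fun _ => dist_nonneg
  have ha := abs_integral_fst_sub_integral_snd_le h hfc hfL
  have hb := abs_integral_fst_sub_integral_snd_le h hgc hgL
  have hfg : ∀ x y, |f x * g x - f y * g y| ≤ 2 * diam (Set.univ : Set X) * dist x y := by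
    intro x y
    calc |f x * g x - f y * g y| = |(f x - f y) * g x + f y * (g x - g y)| := by
          congr 1; ring
      _ ≤ |f x - f y| * |g x| + |f y| * |g x - g y| := by
          rw [← abs_mul, ← abs_mul]; exact abs_add_le _ _
      _ ≤ 1 * dist x y * diam (Set.univ : Set X)
          + diam (Set.univ : Set X) * (1 * dist x y) := by
          have hD : 0 ≤ diam (Set.univ : Set X) := diam_nonneg
          gcongr
          exacts [hfL x y, hgD x, hfD y, hgL x y]
      _ = 2 * diam (Set.univ : Set X) * dist x y := by ring
  have hc := abs_integral_fst_sub_integral_snd_le h (φ := fun x => f x * g x) (by fun_prop) hfg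
  rw [hf0, zero_sub, abs_neg, one_mul] at ha
  rw [hg0, zero_sub, abs_neg, one_mul] at hb
  have hfi := integrable_of_continuous_compact (h.map Prod.snd) hfc
  have hgi := integrable_of_continuous_compact (h.map Prod.snd) hgc
  have hfgi := integrable_of_continuous_compact (h.map Prod.snd)
    (f := fun x => f x * g x) (by fun_prop)
  set W := ∫ p : X × X, dist p.1 p.2 ∂h
  set D := diam (Set.univ : Set X)
  set a := ∫ x, f x ∂(h.map Prod.snd) with ha_def
  set b := ∫ x, g x ∂(h.map Prod.snd) with hb_def
  have hWε : W < ε :=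
    (le_mul_of_one_le_left hW0 (le_max_left _ _)).trans_lt hε
  have hDε : 4 * D * W < ε :=
    (mul_le_mul_of_nonneg_right (le_max_right _ _) hW0).trans_lt hε
  have hcov : ∫ x, (f x - a) * (g x - b) ∂(h.map Prod.snd) =
      ∫ x, f x * g x ∂(h.map Prod.snd) - a * b := by
    have hexp : ∀ x, (f x - a) * (g x - b) = f x * g x - b * f x - a * g x + a * b :=
      fun x => by ring
    have hfb : Integrable (fun x => f x * g x - b * f x) (h.map Prod.snd) :=
      hfgi.sub (hfi.const_mul b)
    have hfba : Integrable (fun x => f x * g x - b * f x - a * g x) (h.map Prod.snd) :=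
      hfb.sub (hgi.const_mul a)
    simp_rw [hexp]
    rw [integral_add hfba (integrable_const _), integral_sub hfb (hgi.const_mul a),
      integral_sub hfgi (hfi.const_mul b), integral_const_mul, integral_const_mul,
      ← ha_def, ← hb_def]
    simp only [integral_const, probReal_univ, one_smul]
    ring
  have hX : Nonempty X := (nonempty_of_isProbabilityMeasure h).map Prod.fst
  refine ⟨fun x => f x - a, fun x => g x - b, ?_, ?_, ?_, ?_, ?_, ?_⟩
  · exact LipschitzWith.of_dist_le_mul fun x y => by simpa using hf.dist_le_mul x y
  · rw [integral_sub hfi (integrable_const _)]; simp [← ha_def]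
  · exact LipschitzWith.of_dist_le_mul fun x y => by simpa using hg.dist_le_mul x y
  · rw [integral_sub hgi (integrable_const _)]; simp [← hb_def]
  · simp only [sub_sub_cancel, ciSup_const]
    exact max_lt (ha.trans_lt hWε) (hb.trans_lt hWε)
  · rw [hcov, sub_sub_eq_add_sub, add_sub_right_comm]
    have hab : |a * b| ≤ D * W := by
      rw [abs_mul]
      exact mul_le_mul (ha.trans hWD) hb (abs_nonneg _) (hW0.trans hWD)
    have hDW : 0 ≤ D * W := mul_nonneg (hW0.trans hWD) hW0
    refine (abs_add_le _ _).trans_lt ?_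
    linarith

theorem admissible_of_coupling (h : Measure (X × X)) [IsProbabilityMeasure h] {ε : ℝ}
    (hε : max 1 (4 * diam (Set.univ : Set X)) * (∫ p : X × X, dist p.1 p.2 ∂h) < ε) :
    Admissible (h.map Prod.fst) (h.map Prod.snd) ε := by
  refine ⟨exists_recentered_observables h hε, ?_⟩
  have : IsProbabilityMeasure (h.map Prod.swap) :=
    Measure.isProbabilityMeasure_map measurable_swap.aemeasurable
  have hfst : (h.map Prod.swap).map Prod.fst = h.map Prod.snd :=
    Measure.map_map measurable_fst measurable_swap
  have hsnd : (h.map Prod.swap).map Prod.snd = h.map Prod.fst :=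
    Measure.map_map measurable_snd measurable_swap
  have hcost : ∫ p : X × X, dist p.1 p.2 ∂(h.map Prod.swap) = ∫ p : X × X, dist p.1 p.2 ∂h := by
    rw [integral_map measurable_swap.aemeasurable continuous_dist.aestronglyMeasurable]
    simp [dist_comm]
  have key := exists_recentered_observables (h.map Prod.swap) (hcost.symm ▸ hε)
  rw [hfst, hsnd] at key
  intro f' g' hf' hf'0 hg' hg'0
  obtain ⟨f, g, hf, hf0, hg, hg0, hsup, hcov⟩ := key f' g' hf' hf'0 hg' hg'0
  refine ⟨f, g, hf, hf0, hg, hg0, ?_, ?_⟩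
  · simpa only [abs_sub_comm] using hsup
  · rwa [abs_sub_comm]

end Coupling

/-- Stability of the observable covariance. With `C_X = max{1, 4 D_X}`,
every `ε > C_X ∫ d dh` (for any coupling `h` of `μ, ν`) is admissible for
`(Σ_μ, Σ_ν)`, and consequently `d_H(Σ_μ, Σ_ν) ≤ C_X · w₁(μ,ν)`. -/
theorem observable_covariance_stability {X : Type*} [MetricSpace X] [CompactSpace X]
    [MeasurableSpace X] [BorelSpace X]
    (μ ν : Measure X) [IsProbabilityMeasure μ] [IsProbabilityMeasure ν] :
    (∀ h : Measure (X × X), IsProbabilityMeasure h →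
      h.map Prod.fst = μ → h.map Prod.snd = ν →
      ∀ ε : ℝ, max 1 (4 * diam (Set.univ : Set X)) * (∫ p : X × X, dist p.1 p.2 ∂h) < ε →
        Admissible μ ν ε) ∧
    sInf {ε : ℝ | 0 < ε ∧ Admissible μ ν ε} ≤
      max 1 (4 * diam (Set.univ : Set X)) *
        ⨅ h : {h : Measure (X × X) // IsProbabilityMeasure h ∧
            h.map Prod.fst = μ ∧ h.map Prod.snd = ν},
          ∫ p : X × X, dist p.1 p.2 ∂h.1 := by
  have hadm : ∀ h : Measure (X × X), IsProbabilityMeasure h →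
      h.map Prod.fst = μ → h.map Prod.snd = ν →
      ∀ ε : ℝ, max 1 (4 * diam (Set.univ : Set X)) * (∫ p : X × X, dist p.1 p.2 ∂h) < ε →
        Admissible μ ν ε := by
    rintro h _ rfl rfl ε hε
    exact admissible_of_coupling h hε
  refine ⟨hadm, ?_⟩
  have hC : 0 ≤ max 1 (4 * diam (Set.univ : Set X)) := zero_le_one.trans (le_max_left _ _)
  have : Nonempty {h : Measure (X × X) // IsProbabilityMeasure h ∧
      h.map Prod.fst = μ ∧ h.map Prod.snd = ν} :=
    ⟨μ.prod ν, inferInstance, by simp, by simp⟩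
  rw [Real.mul_iInf_of_nonneg hC]
  refine le_ciInf fun ⟨h, hP, hfst, hsnd⟩ => le_of_forall_gt_imp_ge_of_dense fun ε hε => ?_
  have hε0 : 0 < ε := (mul_nonneg hC (integral_nonneg fun _ => dist_nonneg)).trans_lt hε
  exact csInf_le ⟨0, fun _ h => h.1.le⟩ ⟨hε0, hadm h hP hfst hsnd ε hε⟩
end

section
/- Let (X,d,μ) and (X',d',μ') be metric measure spaces with X, X' compact, and p ≥ 1. For every metric coupling δ and every probabilistic coupling h of μ and μ', the correspondence R_δ between Obs(X) and Obs(X') satisfies: (i) its structural distortion with respect to the pseudometrics d_{p,μ}(f,g) = (∫_X |f−g|^p dμ)^{1/p} on Obs(X) and d_{p,μ'} on Obs(X') is at most 2 (∫_{X×X'} δ^p(x,y) dh(x,y))^{1/p}; and (ii) its functional distortion with respect to the functions M_μ(f) = ∫_X f dμ and M_{μ'}(f') = ∫_{X'} f' dμ' is at most (∫_{X×X'} δ^p(x,y) dh(x,y))^{1/p}. Consequently (1/2) max{dis(R_δ), 2 fdis(R_δ)} ≤ (∫_{X×X'} δ^p dh)^{1/p}, so the Gromov–Hausdorff distance between the functional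 pseudometric spaces (Obs(X), d_{p,μ}, M_μ) and (Obs(X'), d_{p,μ'}, M_{μ'}) is at most the Kantorovich–Sturm p-distance of (X,d,μ) and (X',d',μ'). -/
open MeasureTheory Metric

/-- The support of a measure: points all of whose neighborhoods have positive measure. -/
def msupport {X : Type*} [TopologicalSpace X] [MeasurableSpace X] (μ : Measure X) : Set X :=
  {x : X | ∀ U ∈ nhds x, 0 < μ U}

/-- `δ` is a metric coupling of `(X,d,μ)` and `(X',d',μ')`. -/
def MetricCoupling {X X' : Type*} [MetricSpace X] [MetricSpace X']
    [MeasurableSpace X] [MeasurableSpace X']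
    (μ : Measure X) (μ' : Measure X') (δ : X ⊕ X' → X ⊕ X' → ℝ) : Prop :=
  (∀ z, δ z z = 0) ∧ (∀ z w, δ z w = δ w z) ∧
  (∀ z w u, δ z u ≤ δ z w + δ w u) ∧ (∀ z w, δ z w = 0 → z = w) ∧
  (∀ x ∈ msupport μ, ∀ y ∈ msupport μ, δ (Sum.inl x) (Sum.inl y) = dist x y) ∧
  (∀ x ∈ msupport μ', ∀ y ∈ msupport μ', δ (Sum.inr x) (Sum.inr y) = dist x y)

/-- The function `f ⊔ f'` on `K ⊔ K'` is 1-Lipschitz with respect to `δ`. -/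
def SqcupLipschitz {X X' : Type*} (K : Set X) (K' : Set X')
    (δ : X ⊕ X' → X ⊕ X' → ℝ) (f : X → ℝ) (f' : X' → ℝ) : Prop :=
  ∀ z ∈ Sum.inl '' K ∪ Sum.inr '' K', ∀ w ∈ Sum.inl '' K ∪ Sum.inr '' K',
    |Sum.elim f f' z - Sum.elim f f' w| ≤ δ z w

/-- Structural distortion of a relation between two pseudometric spaces
(with pseudometrics given as real-valued functions), valued in `ℝ≥0∞`. -/
noncomputable def relDistortion {α β : Type*} (D : α → α → ℝ) (D' : β → β → ℝ)
    (R : Set (α × β)) : ENNReal :=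
  ⨆ q ∈ R, ⨆ r ∈ R, ENNReal.ofReal |D q.1 r.1 - D' q.2 r.2|

/-- Functional distortion of a relation with respect to real-valued functions. -/
noncomputable def relFunDistortion {α β : Type*} (φ : α → ℝ) (ψ : β → ℝ)
    (R : Set (α × β)) : ENNReal :=
  ⨆ q ∈ R, ENNReal.ofReal |φ q.1 - ψ q.2|

/-- A correspondence: a relation whose projections are both surjective. -/
def IsCorrespondence {α β : Type*} (R : Set (α × β)) : Prop :=
  (∀ a, ∃ b, (a, b) ∈ R) ∧ (∀ b, ∃ a, (a, b) ∈ R)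

/-- The Gromov–Hausdorff distance between functional pseudometric spaces
`(α, D, φ)` and `(β, D', ψ)`: `(1/2) inf_R max{dis(R), 2 fdis(R)}` over
correspondences `R`. -/
noncomputable def funGH {α β : Type*} (D : α → α → ℝ) (D' : β → β → ℝ)
    (φ : α → ℝ) (ψ : β → ℝ) : ENNReal :=
  (1 / 2) * ⨅ R ∈ {R : Set (α × β) | IsCorrespondence R},
    max (relDistortion D D' R) (2 * relFunDistortion φ ψ R)

/-- The Kantorovich–Sturm `p`-distance: the infimum over metric couplings `δ` and
probabilistic couplings `h` of `(∫ δ^p dh)^{1/p}`. -/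
noncomputable def dKS {X X' : Type*} [MetricSpace X] [MetricSpace X']
    [MeasurableSpace X] [MeasurableSpace X']
    (μ : Measure X) (μ' : Measure X') (p : ℝ) : ENNReal :=
  ⨅ δ ∈ {δ : X ⊕ X' → X ⊕ X' → ℝ | MetricCoupling μ μ' δ},
    ⨅ h ∈ {h : Measure (X × X') | IsProbabilityMeasure h ∧
        h.map Prod.fst = μ ∧ h.map Prod.snd = μ'},
      ENNReal.ofReal ((∫ q : X × X', δ (Sum.inl q.1) (Sum.inr q.2) ^ p ∂h) ^ (1 / p))

section LpNorm

variable {Z : Type*} [MeasurableSpace Z] {h : Measure Z} {p : ℝ}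

lemma rpow_integral_abs_rpow_eq_lpNorm (hp : 1 ≤ p) {F : Z → ℝ} (hF : AEStronglyMeasurable F h) :
    (∫ z, |F z| ^ p ∂h) ^ (1 / p) = lpNorm F (ENNReal.ofReal p) h := by
  have hp₀ : 0 < p := by linarith
  rw [lpNorm_eq_integral_norm_rpow_toReal (by simpa using hp₀) ENNReal.ofReal_ne_top hF,
    ENNReal.toReal_ofReal hp₀.le, one_div]
  simp only [Real.norm_eq_abs]

lemma lpNorm_mono_ae_real {q : ENNReal} {F D : Z → ℝ} (hD : MemLp D q h)
    (hFD : ∀ᵐ z ∂h, |F z| ≤ D z) : lpNorm F q h ≤ lpNorm D q h := by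
  by_cases hF : AEStronglyMeasurable F h
  · rw [← toReal_eLpNorm hF, ← toReal_eLpNorm hD.1]
    exact ENNReal.toReal_mono hD.eLpNorm_ne_top (eLpNorm_mono_ae_real hFD)
  · simp [hF]

lemma abs_lpNorm_sub_lpNorm_le {q : ENNReal} (hq : 1 ≤ q) {F G : Z → ℝ} (hF : MemLp F q h)
    (hG : MemLp G q h) : |lpNorm F q h - lpNorm G q h| ≤ lpNorm (F - G) q h := by
  have h₁ := lpNorm_le_lpNorm_add_lpNorm_sub' (f := F) hG hq
  have h₂ := lpNorm_le_lpNorm_add_lpNorm_sub (f := G) hF hq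
  rw [abs_le]
  constructor <;> linarith

lemma abs_integral_sub_integral_le_lpNorm [IsProbabilityMeasure h] {q : ENNReal} (hq : 1 ≤ q)
    {F G D : Z → ℝ} (hF : Integrable F h) (hG : Integrable G h) (hD : MemLp D q h)
    (hFG : ∀ᵐ z ∂h, |F z - G z| ≤ D z) :
    |∫ z, F z ∂h - ∫ z, G z ∂h| ≤ lpNorm D q h := by
  have hFG_int : Integrable (fun z => F z - G z) h := hF.sub hG
  calc |∫ z, F z ∂h - ∫ z, G z ∂h|
      = |∫ z, (F z - G z) ∂h| := by rw [integral_sub hF hG]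
    _ ≤ ∫ z, ‖F z - G z‖ ∂h := norm_integral_le_integral_norm (fun z => F z - G z)
    _ = lpNorm (fun z => F z - G z) 1 h := (lpNorm_one_eq_integral_norm hFG_int.1).symm
    _ ≤ lpNorm D 1 h := lpNorm_mono_ae_real (hD.mono_exponent hq) hFG
    _ ≤ lpNorm D q h := by
      rw [← toReal_eLpNorm hD.1, ← toReal_eLpNorm hD.1]
      exact ENNReal.toReal_mono hD.eLpNorm_ne_top (eLpNorm_le_eLpNorm_of_exponent_le hq hD.1)

end LpNorm

section Support

variable {X : Type*} [TopologicalSpace X] [MeasurableSpace X]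

lemma msupport_eq_support (μ : Measure X) : msupport μ = μ.support :=
  Set.ext fun x => (Measure.mem_support_iff_forall x).symm

lemma ae_mem_msupport [HereditarilyLindelofSpace X] (μ : Measure X) :
    ∀ᵐ x ∂μ, x ∈ msupport μ := by
  rw [msupport_eq_support]
  exact Measure.support_mem_ae

lemma ae_mem_msupport_of_coupling {X' : Type*} [TopologicalSpace X'] [MeasurableSpace X']
    [HereditarilyLindelofSpace X] [HereditarilyLindelofSpace X']
    {μ : Measure X} {μ' : Measure X'} {h : Measure (X × X')}
    (h₁ : h.map Prod.fst = μ) (h₂ : h.map Prod.snd = μ') :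
    ∀ᵐ q ∂h, q.1 ∈ msupport μ ∧ q.2 ∈ msupport μ' :=
  (ae_of_ae_map measurable_fst.aemeasurable (h₁ ▸ ae_mem_msupport μ)).and
    (ae_of_ae_map measurable_snd.aemeasurable (h₂ ▸ ae_mem_msupport μ'))

end Support

lemma Continuous.memLp_of_compactSpace {Z : Type*} [TopologicalSpace Z] [CompactSpace Z]
    [MeasurableSpace Z] [OpensMeasurableSpace Z] {h : Measure Z} [IsFiniteMeasure h]
    {F : Z → ℝ} (hF : Continuous F) (q : ENNReal) : MemLp F q h :=
  hF.memLp_of_hasCompactSupport (HasCompactSupport.of_compactSpace F)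

namespace MetricCoupling

variable {X X' : Type*} [MetricSpace X] [MetricSpace X'] [MeasurableSpace X] [MeasurableSpace X']
  {μ : Measure X} {μ' : Measure X'} {δ : X ⊕ X' → X ⊕ X' → ℝ}

lemma nonneg (hδ : MetricCoupling μ μ' δ) (z w : X ⊕ X') : 0 ≤ δ z w := by
  obtain ⟨h₀, hsymm, htri, -⟩ := hδ
  linarith [htri z w z, h₀ z, hsymm z w]

/-- The pseudometric on `X ⊕ X'` underlying a metric coupling. -/
abbrev toPseudoMetricSpace (hδ : MetricCoupling μ μ' δ) : PseudoMetricSpace (X ⊕ X') where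
  dist := δ
  dist_self := hδ.1
  dist_comm := hδ.2.1
  dist_triangle := hδ.2.2.1

lemma symm (hδ : MetricCoupling μ μ' δ) :
    MetricCoupling μ' μ (fun z w => δ z.swap w.swap) := by
  obtain ⟨h₀, hsymm, htri, heq, hX, hX'⟩ := hδ
  exact ⟨fun z => h₀ _, fun z w => hsymm _ _, fun z w u => htri _ _ _,
    fun z w hzw => Sum.swap_leftInverse.injective (heq _ _ hzw), hX', hX⟩

/-- On the product of the supports, a metric coupling agrees with a continuous function. -/
lemma exists_continuous_eqOn (hδ : MetricCoupling μ μ' δ) :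
    ∃ D : X × X' → ℝ, Continuous D ∧
      ∀ q : X × X', q.1 ∈ msupport μ → q.2 ∈ msupport μ' →
        δ (Sum.inl q.1) (Sum.inr q.2) = D q := by
  obtain ⟨-, hsymm, htri, -, hX, hX'⟩ := hδ
  have hlip : LipschitzOnWith 2 (fun q : X × X' => δ (Sum.inl q.1) (Sum.inr q.2))
      (msupport μ ×ˢ msupport μ') := by
    refine LipschitzOnWith.of_le_add_mul _ fun a ha b hb => ?_
    have h₁ := htri (Sum.inl a.1) (Sum.inl b.1) (Sum.inr a.2)
    have h₂ := htri (Sum.inl b.1) (Sum.inr b.2) (Sum.inr a.2)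
    rw [hX _ ha.1 _ hb.1] at h₁
    rw [hX' _ hb.2 _ ha.2, dist_comm] at h₂
    have h₃ : dist a.1 b.1 ≤ dist a b := le_max_left _ _
    have h₄ : dist a.2 b.2 ≤ dist a b := le_max_right _ _
    push_cast
    linarith
  obtain ⟨D, hD, heq⟩ := hlip.extend_real
  exact ⟨D, hD.continuous, fun q h₁ h₂ => heq ⟨h₁, h₂⟩⟩

lemma memLp [CompactSpace X] [CompactSpace X'] [BorelSpace X] [BorelSpace X']
    (hδ : MetricCoupling μ μ' δ) {h : Measure (X × X')} [IsFiniteMeasure h]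
    (h₁ : h.map Prod.fst = μ) (h₂ : h.map Prod.snd = μ') (q : ENNReal) :
    MemLp (fun z : X × X' => δ (Sum.inl z.1) (Sum.inr z.2)) q h := by
  obtain ⟨D, hD, heq⟩ := hδ.exists_continuous_eqOn
  refine (memLp_congr_ae ?_).2 (hD.memLp_of_compactSpace q)
  filter_upwards [ae_mem_msupport_of_coupling h₁ h₂] with z hz using heq z hz.1 hz.2

/-- Every observable on `X` has a partner on `X'` (McShane extension). -/
lemma exists_sqcupLipschitz (hδ : MetricCoupling μ μ' δ) {f : X → ℝ} (hf : LipschitzWith 1 f) :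
    ∃ f' : X' → ℝ, LipschitzWith 1 f' ∧ SqcupLipschitz (msupport μ) (msupport μ') δ f f' := by
  have key : ∃ g : X ⊕ X' → ℝ, (∀ z w, |g z - g w| ≤ δ z w) ∧
      ∀ x ∈ msupport μ, f x = g (Sum.inl x) := by
    let _ := hδ.toPseudoMetricSpace
    have hlip : LipschitzOnWith 1 (Sum.elim f fun _ : X' => (0 : ℝ))
        (Sum.inl '' msupport μ) := by
      refine LipschitzOnWith.of_le_add ?_
      rintro _ ⟨x, hx, rfl⟩ _ ⟨y, hy, rfl⟩
      have hxy : dist (Sum.inl x : X ⊕ X') (Sum.inl y) = dist x y := hδ.2.2.2.2.1 x hx y hy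
      rw [hxy]
      have := hf.dist_le_mul x y
      rw [Real.dist_eq, NNReal.coe_one, one_mul] at this
      simpa using sub_le_iff_le_add'.1 ((le_abs_self _).trans this)
    obtain ⟨g, hg, heq⟩ := hlip.extend_real
    refine ⟨g, fun z w => ?_, fun x hx => heq ⟨x, hx, rfl⟩⟩
    simpa [Real.dist_eq] using! hg.dist_le_mul z w
  obtain ⟨g, hg, hfg⟩ := key
  have hlip' : LipschitzOnWith 1 (fun y : X' => g (Sum.inr y)) (msupport μ') := by
    refine LipschitzOnWith.of_le_add fun x hx y hy => ?_
    have := hg (Sum.inr x) (Sum.inr y)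
    rw [hδ.2.2.2.2.2 x hx y hy] at this
    linarith [le_abs_self (g (Sum.inr x) - g (Sum.inr y))]
  obtain ⟨f', hf', heq⟩ := hlip'.extend_real
  have hval : ∀ z ∈ Sum.inl '' msupport μ ∪ Sum.inr '' msupport μ', Sum.elim f f' z = g z := by
    rintro _ (⟨x, hx, rfl⟩ | ⟨y, hy, rfl⟩)
    · exact hfg x hx
    · exact (heq hy).symm
  exact ⟨f', hf', fun z hz w hw => by rw [hval z hz, hval w hw]; exact hg z w⟩

lemma isCorrespondence (hδ : MetricCoupling μ μ' δ) :
    IsCorrespondence {q : {f : X → ℝ // LipschitzWith 1 f} × {f' : X' → ℝ // LipschitzWith 1 f'} |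
      SqcupLipschitz (msupport μ) (msupport μ') δ q.1.1 q.2.1} := by
  constructor
  · rintro ⟨f, hf⟩
    obtain ⟨f', hf', hff'⟩ := hδ.exists_sqcupLipschitz hf
    exact ⟨⟨f', hf'⟩, hff'⟩
  · rintro ⟨f', hf'⟩
    obtain ⟨f, hf, hff'⟩ := hδ.symm.exists_sqcupLipschitz hf'
    refine ⟨⟨f, hf⟩, ?_⟩
    have hmem : ∀ z ∈ Sum.inl '' msupport μ ∪ Sum.inr '' msupport μ',
        z.swap ∈ Sum.inl '' msupport μ' ∪ Sum.inr '' msupport μ ∧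
          Sum.elim f' f z.swap = Sum.elim f f' z := by
      rintro _ (⟨x, hx, rfl⟩ | ⟨y, hy, rfl⟩)
      · exact ⟨Or.inr ⟨x, hx, rfl⟩, rfl⟩
      · exact ⟨Or.inl ⟨y, hy, rfl⟩, rfl⟩
    intro z hz w hw
    have := hff' _ (hmem z hz).1 _ (hmem w hw).1
    simpa only [(hmem z hz).2, (hmem w hw).2, Sum.swap_swap] using this

variable [CompactSpace X] [CompactSpace X'] [BorelSpace X] [BorelSpace X']
  {h : Measure (X × X')} [IsProbabilityMeasure h] {p : ℝ}

lemma rpow_integral_eq_lpNorm (hδ : MetricCoupling μ μ' δ)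
    (h₁ : h.map Prod.fst = μ) (h₂ : h.map Prod.snd = μ') (hp : 1 ≤ p) :
    (∫ q : X × X', δ (Sum.inl q.1) (Sum.inr q.2) ^ p ∂h) ^ (1 / p) =
      lpNorm (fun q : X × X' => δ (Sum.inl q.1) (Sum.inr q.2)) (ENNReal.ofReal p) h := by
  rw [← rpow_integral_abs_rpow_eq_lpNorm hp (hδ.memLp h₁ h₂ 1).1]
  simp only [abs_of_nonneg (hδ.nonneg _ _)]

lemma relDistortion_le (hδ : MetricCoupling μ μ' δ)
    (h₁ : h.map Prod.fst = μ) (h₂ : h.map Prod.snd = μ') (hp : 1 ≤ p) :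
    relDistortion
        (fun f g : {f : X → ℝ // LipschitzWith 1 f} =>
          (∫ x, |f.1 x - g.1 x| ^ p ∂μ) ^ (1 / p))
        (fun f' g' : {f' : X' → ℝ // LipschitzWith 1 f'} =>
          (∫ x, |f'.1 x - g'.1 x| ^ p ∂μ') ^ (1 / p))
        {q | SqcupLipschitz (msupport μ) (msupport μ') δ q.1.1 q.2.1} ≤
      ENNReal.ofReal
        (2 * (∫ q : X × X', δ (Sum.inl q.1) (Sum.inr q.2) ^ p ∂h) ^ (1 / p)) := by
  refine iSup₂_le ?_
  rintro ⟨⟨f, hf⟩, f', hf'⟩ hff'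
  refine iSup₂_le ?_
  rintro ⟨⟨g, hg⟩, g', hg'⟩ hgg'
  refine ENNReal.ofReal_le_ofReal ?_
  have hq : 1 ≤ ENNReal.ofReal p := by simpa using hp
  have hFc : Continuous fun q : X × X' => f q.1 - g q.1 :=
    (hf.continuous.comp continuous_fst).sub (hg.continuous.comp continuous_fst)
  have hGc : Continuous fun q : X × X' => f' q.2 - g' q.2 :=
    (hf'.continuous.comp continuous_snd).sub (hg'.continuous.comp continuous_snd)
  have hF : ∫ x, |f x - g x| ^ p ∂μ = ∫ q, |f q.1 - g q.1| ^ p ∂h := by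
    rw [← h₁]
    exact integral_map measurable_fst.aemeasurable
      ((hf.continuous.sub hg.continuous).abs.rpow_const
        fun _ => Or.inr (by linarith)).aestronglyMeasurable
  have hG : ∫ x, |f' x - g' x| ^ p ∂μ' = ∫ q, |f' q.2 - g' q.2| ^ p ∂h := by
    rw [← h₂]
    exact integral_map measurable_snd.aemeasurable
      ((hf'.continuous.sub hg'.continuous).abs.rpow_const
        fun _ => Or.inr (by linarith)).aestronglyMeasurable
  have hD := hδ.memLp h₁ h₂ (ENNReal.ofReal p)
  simp only
  rw [hF, hG, rpow_integral_abs_rpow_eq_lpNorm hp hFc.aestronglyMeasurable,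
    rpow_integral_abs_rpow_eq_lpNorm hp hGc.aestronglyMeasurable,
    hδ.rpow_integral_eq_lpNorm h₁ h₂ hp]
  refine (abs_lpNorm_sub_lpNorm_le hq (hFc.memLp_of_compactSpace _)
    (hGc.memLp_of_compactSpace _)).trans
    ((lpNorm_mono_ae_real (hD.const_smul (2 : ℝ)) ?_).trans_eq ?_)
  · filter_upwards [ae_mem_msupport_of_coupling h₁ h₂] with z hz
    have hf_le := abs_le.1 (hff' _ (Or.inl ⟨z.1, hz.1, rfl⟩) _ (Or.inr ⟨z.2, hz.2, rfl⟩))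
    have hg_le := abs_le.1 (hgg' _ (Or.inl ⟨z.1, hz.1, rfl⟩) _ (Or.inr ⟨z.2, hz.2, rfl⟩))
    simp only [Sum.elim_inl, Sum.elim_inr, Pi.sub_apply, Pi.smul_apply, smul_eq_mul]
      at hf_le hg_le ⊢
    rw [abs_le]
    constructor <;> linarith
  · rw [lpNorm_const_smul]
    simp

lemma relFunDistortion_le (hδ : MetricCoupling μ μ' δ)
    (h₁ : h.map Prod.fst = μ) (h₂ : h.map Prod.snd = μ') (hp : 1 ≤ p) :
    relFunDistortion
        (fun f : {f : X → ℝ // LipschitzWith 1 f} => ∫ x, f.1 x ∂μ)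
        (fun f' : {f' : X' → ℝ // LipschitzWith 1 f'} => ∫ x, f'.1 x ∂μ')
        {q | SqcupLipschitz (msupport μ) (msupport μ') δ q.1.1 q.2.1} ≤
      ENNReal.ofReal
        ((∫ q : X × X', δ (Sum.inl q.1) (Sum.inr q.2) ^ p ∂h) ^ (1 / p)) := by
  refine iSup₂_le ?_
  rintro ⟨⟨f, hf⟩, f', hf'⟩ hff'
  refine ENNReal.ofReal_le_ofReal ?_
  have hq : 1 ≤ ENNReal.ofReal p := by simpa using hp
  have hF : ∫ x, f x ∂μ = ∫ q, f q.1 ∂h := by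
    rw [← h₁]
    exact integral_map measurable_fst.aemeasurable hf.continuous.aestronglyMeasurable
  have hG : ∫ x, f' x ∂μ' = ∫ q, f' q.2 ∂h := by
    rw [← h₂]
    exact integral_map measurable_snd.aemeasurable hf'.continuous.aestronglyMeasurable
  simp only
  rw [hF, hG, hδ.rpow_integral_eq_lpNorm h₁ h₂ hp]
  refine abs_integral_sub_integral_le_lpNorm hq
    (memLp_one_iff_integrable.1 ((hf.continuous.comp continuous_fst).memLp_of_compactSpace 1))
    (memLp_one_iff_integrable.1 ((hf'.continuous.comp continuous_snd).memLp_of_compactSpace 1))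
    (hδ.memLp h₁ h₂ _) ?_
  filter_upwards [ae_mem_msupport_of_coupling h₁ h₂] with z hz
  exact hff' _ (Or.inl ⟨z.1, hz.1, rfl⟩) _ (Or.inr ⟨z.2, hz.2, rfl⟩)

end MetricCoupling

/-- Heterogeneous stability of the observable mean. For every metric
coupling `δ` and probabilistic coupling `h`, the correspondence `R_δ` between the
observable spaces `(Obs(X), d_{p,μ})` and `(Obs(X'), d_{p,μ'})` has structural
distortion at most `2 (∫ δ^p dh)^{1/p}` and functional distortion (for the observable
means) at most `(∫ δ^p dh)^{1/p}`; consequently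
`d_GH((Obs(X), d_{p,μ}, M_μ), (Obs(X'), d_{p,μ'}, M_{μ'})) ≤ d_{KS,p}(μ, μ')`. -/
theorem observable_mean_heterogeneous_stability {X X' : Type*}
    [MetricSpace X] [CompactSpace X] [MeasurableSpace X] [BorelSpace X]
    [MetricSpace X'] [CompactSpace X'] [MeasurableSpace X'] [BorelSpace X']
    (μ : Measure X) [IsProbabilityMeasure μ] (μ' : Measure X') [IsProbabilityMeasure μ']
    (p : ℝ) (hp : 1 ≤ p) :
    (∀ δ : X ⊕ X' → X ⊕ X' → ℝ, MetricCoupling μ μ' δ →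
      ∀ h : Measure (X × X'), IsProbabilityMeasure h →
        h.map Prod.fst = μ → h.map Prod.snd = μ' →
        relDistortion
            (fun f g : {f : X → ℝ // LipschitzWith 1 f} =>
              (∫ x, |f.1 x - g.1 x| ^ p ∂μ) ^ (1 / p))
            (fun f' g' : {f' : X' → ℝ // LipschitzWith 1 f'} =>
              (∫ x, |f'.1 x - g'.1 x| ^ p ∂μ') ^ (1 / p))
            {q | SqcupLipschitz (msupport μ) (msupport μ') δ q.1.1 q.2.1} ≤
          ENNReal.ofReal
            (2 * (∫ q : X × X', δ (Sum.inl q.1) (Sum.inr q.2) ^ p ∂h) ^ (1 / p)) ∧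
        relFunDistortion
            (fun f : {f : X → ℝ // LipschitzWith 1 f} => ∫ x, f.1 x ∂μ)
            (fun f' : {f' : X' → ℝ // LipschitzWith 1 f'} => ∫ x, f'.1 x ∂μ')
            {q | SqcupLipschitz (msupport μ) (msupport μ') δ q.1.1 q.2.1} ≤
          ENNReal.ofReal
            ((∫ q : X × X', δ (Sum.inl q.1) (Sum.inr q.2) ^ p ∂h) ^ (1 / p))) ∧
    funGH
        (fun f g : {f : X → ℝ // LipschitzWith 1 f} =>
          (∫ x, |f.1 x - g.1 x| ^ p ∂μ) ^ (1 / p))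
        (fun f' g' : {f' : X' → ℝ // LipschitzWith 1 f'} =>
          (∫ x, |f'.1 x - g'.1 x| ^ p ∂μ') ^ (1 / p))
        (fun f => ∫ x, f.1 x ∂μ) (fun f' => ∫ x, f'.1 x ∂μ') ≤
      dKS μ μ' p := by
  refine ⟨fun δ hδ h hh h₁ h₂ => ⟨hδ.relDistortion_le h₁ h₂ hp, hδ.relFunDistortion_le h₁ h₂ hp⟩, ?_⟩
  refine le_iInf₂ fun δ hδ => le_iInf₂ fun h hh => ?_
  obtain ⟨hprob, h₁, h₂⟩ := hh
  have hδ' : MetricCoupling μ μ' δ := hδ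
  have hdis := hδ'.relDistortion_le h₁ h₂ hp
  rw [ENNReal.ofReal_mul (by norm_num), ENNReal.ofReal_ofNat] at hdis
  calc funGH _ _ _ _
      ≤ 1 / 2 * (2 * ENNReal.ofReal
          ((∫ q : X × X', δ (Sum.inl q.1) (Sum.inr q.2) ^ p ∂h) ^ (1 / p))) := by
        refine mul_le_mul_right (iInf₂_le_of_le _ hδ'.isCorrespondence (max_le hdis ?_)) _
        exact mul_le_mul_right (hδ'.relFunDistortion_le h₁ h₂ hp) _
    _ = ENNReal.ofReal ((∫ q : X × X', δ (Sum.inl q.1) (Sum.inr q.2) ^ p ∂h) ^ (1 / p)) := by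
        rw [← mul_assoc, one_div, ENNReal.inv_mul_cancel two_ne_zero ENNReal.ofNat_ne_top, one_mul]
end
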